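/- Let Λ be a metric space equipped with its Borel σ-algebra, let λ^H ∈ Λ, and let (p_t)_{t∈ℕ} be a sequence of Borel probability measures on Λ converging weakly to the Dirac measure δ_{λ^H}. Let Σ and L be finite nonempty sets, let U : Λ × L → ℝ be bounded and continuous in its first argument for each l ∈ L, and let λ̂ : Λ × Σ → ℝ be bounded and continuous in its first argument for each σ ∈ Σ, with λ̂(x, σ) ≥ 0 for all x, σ and ∑_{σ∈Σ} λ̂(x, σ) = 1 for all x ∈ Λ. Then EVSI(p_t) → 0 as t → ∞. (This is the measure-theoretic content of Proposition 1: under convergence in distribution of the estimated feedback profile, the competence-aware system converges to λ-stationarity.) -/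

import Mathlib

open MeasureTheory Filter Topology

/-- A probability vector splits a finite supremum into a sum of weighted suprema. -/
lemma sum_sup'_mul_eq_sup' {ι κ : Type*} [Fintype ι] {s : Finset κ} (hs : s.Nonempty)
    (u : κ → ℝ) (w : ι → ℝ) (hw : ∀ i, 0 ≤ w i) (hsum : ∑ i, w i = 1) :
    ∑ i, s.sup' hs (fun l => u l * w i) = s.sup' hs u := by
  simp_rw [← Finset.sup'_mul₀ (hw _), ← Finset.mul_sum, hsum, mul_one]

/-- If the posterior measures `p t` converge weakly to the Dirac measure at the
true feedback profile `lamH`, then the expected value of sample information `EVSI (p t)`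
converges to `0` (Proposition 1: convergence to λ-stationarity). -/
theorem evsi_tendsto_zero_of_weak_tendsto_dirac
    {Λ : Type*} [MetricSpace Λ] [MeasurableSpace Λ] [BorelSpace Λ]
    (lamH : Λ) (p : ℕ → Measure Λ) (hp : ∀ t, IsProbabilityMeasure (p t))
    -- weak convergence of `p t` to `Measure.dirac lamH` : convergence of integrals of all
    -- bounded continuous real-valued functions
    (hweak : ∀ f : Λ → ℝ, Continuous f → (∃ C, ∀ x, |f x| ≤ C) →
      Tendsto (fun t => ∫ x, f x ∂(p t)) atTop (𝓝 (∫ x, f x ∂(Measure.dirac lamH))))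
    {Sig L : Type*} [Fintype Sig] [Nonempty Sig] [Fintype L] [Nonempty L]
    (U : Λ → L → ℝ)
    (hUcont : ∀ l, Continuous (fun x => U x l))
    (hUbdd : ∀ l, ∃ C, ∀ x, |U x l| ≤ C)
    (lamHat : Λ → Sig → ℝ)
    (hlamCont : ∀ σ, Continuous (fun x => lamHat x σ))
    (hlamBdd : ∀ σ, ∃ C, ∀ x, |lamHat x σ| ≤ C)
    (hlamNonneg : ∀ x σ, 0 ≤ lamHat x σ)
    (hlamSum : ∀ x, ∑ σ, lamHat x σ = 1) :
    Tendsto (fun t =>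
        (∑ σ, Finset.univ.sup' Finset.univ_nonempty
            (fun l => ∫ x, U x l * lamHat x σ ∂(p t)))
        - Finset.univ.sup' Finset.univ_nonempty (fun l => ∫ x, U x l ∂(p t)))
      atTop (𝓝 0) := by
  have hU (l : L) : Tendsto (fun t => ∫ x, U x l ∂(p t)) atTop (𝓝 (U lamH l)) := by
    simpa only [integral_dirac] using hweak _ (hUcont l) (hUbdd l)
  have hUlam (σ : Sig) (l : L) : Tendsto (fun t => ∫ x, U x l * lamHat x σ ∂(p t)) atTop
      (𝓝 (U lamH l * lamHat lamH σ)) := by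
    obtain ⟨C, hC⟩ := hUbdd l
    obtain ⟨D, hD⟩ := hlamBdd σ
    simpa only [integral_dirac] using hweak (fun x => U x l * lamHat x σ)
      ((hUcont l).mul (hlamCont σ)) ⟨C * D, fun x => by
        rw [abs_mul]
        exact mul_le_mul (hC x) (hD x) (abs_nonneg _) ((abs_nonneg _).trans (hC x))⟩
  have hsum := tendsto_finsetSum Finset.univ fun σ (_ : σ ∈ Finset.univ) =>
    Tendsto.finset_sup'_nhds_apply Finset.univ_nonempty fun l _ => hUlam σ l
  have hsup := Tendsto.finset_sup'_nhds_apply Finset.univ_nonempty fun l _ => hU l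
  have hdiff := hsum.sub hsup
  rwa [sum_sup'_mul_eq_sup' _ (U lamH) (lamHat lamH) (hlamNonneg lamH) (hlamSum lamH),
    sub_self] at hdiff
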